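/- Let α ≥ β ≥ γ ≥ 1 be real numbers, let η = 1/α + 1/β + 1/γ, and set A = α(1+η), B = β(1+η), C = γ(1+η). Then the number of triples (x₁,x₂,x₃) of strictly positive integers with x₁/A + x₂/B + x₃/C ≤ 1 is at most (A−1)(B−1)(C−1)/6. -/

import Mathlib

lemma aux_sum1 (c : ℝ) (m : ℕ) :
    ∑ j ∈ Finset.range (m + 1), (c - j) = (m + 1) * c - m * (m + 1) / 2 := by
  induction m with
  | zero => simp
  | succ n ih => rw [Finset.sum_range_succ, ih]; push_cast; ring

lemma aux_sum2 (c : ℝ) (m : ℕ) :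
    ∑ j ∈ Finset.range (m + 1), (c - j) ^ 2 =
      (m + 1) * c ^ 2 - c * (m * (m + 1)) + m * (m + 1) * (2 * m + 1) / 6 := by
  induction m with
  | zero => simp
  | succ n ih => rw [Finset.sum_range_succ, ih]; push_cast; ring

lemma aux_inner (b s : ℝ) (hb : 0 ≤ b) (hs : 1 ≤ s) :
    ∑ j ∈ Finset.range (⌊b⌋₊ + 1), (s * (b - j) + 1) ≤
      (b + 1) * (b + 2) / 2 + (s - 1) * (b * (b + 1) + 1 / 4) / 2 := by
  rw [Finset.sum_add_distrib, ← Finset.mul_sum, aux_sum1]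
  have h1 := Nat.floor_le hb
  simp only [Finset.sum_const, Finset.card_range, nsmul_eq_mul]
  push_cast
  generalize (⌊b⌋₊ : ℝ) = m at *
  obtain ⟨f, rfl⟩ : ∃ f, b = m + f := ⟨b - m, by ring⟩
  have hf : 0 ≤ f := by linarith
  nlinarith [mul_nonneg (sub_nonneg.2 hs) (sq_nonneg (f - 1 / 2)), sq_nonneg f]

lemma aux_poly (r g s : ℝ) (hr : 1 ≤ r) (hg : 1 ≤ g) (hs : 1 ≤ s) :
    s * r * (3 * (r ^ 2 * (g ^ 3 / 3 + g ^ 2 / 2 + g / 6 + 1 / 24)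
        + 3 * r * ((g ^ 2 + g) / 2 + 1 / 8) + 2 * (g + 1))
      + 3 * (s - 1) * (r ^ 2 * (g ^ 3 / 3 + g ^ 2 / 2 + g / 6 + 1 / 24)
        + r * ((g ^ 2 + g) / 2 + 1 / 8) + (g + 1) / 4))
    ≤ (r * g + r + 1) * (s * r * g + s * r + 1) * (s * r * g + s + 1) := by
  obtain ⟨p, rfl⟩ : ∃ p, r = 1 + p := ⟨r - 1, by ring⟩
  obtain ⟨q, rfl⟩ : ∃ q, g = 1 + q := ⟨g - 1, by ring⟩
  obtain ⟨w, rfl⟩ : ∃ w, s = 1 + w := ⟨s - 1, by ring⟩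
  have hp : 0 ≤ p := by linarith
  have hq : 0 ≤ q := by linarith
  have hw : 0 ≤ w := by linarith
  rw [← sub_nonneg]
  ring_nf
  positivity

lemma aux_outer (r g s : ℝ) (hr : 1 ≤ r) (hg : 1 ≤ g) (hs : 1 ≤ s) :
    ∑ k ∈ Finset.range (⌊g⌋₊ + 1), ((r * (g - k) + 1) * (r * (g - k) + 2) / 2
      + (s - 1) * (r * (g - k) * (r * (g - k) + 1) + 1 / 4) / 2) ≤
    (r * g + r + 1) * (s * r * g + s * r + 1) * (s * r * g + s + 1) / (s * r) / 6 := by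
  have h1 : (⌊g⌋₊ : ℝ) ≤ g := Nat.floor_le (by linarith)
  have h2 : g < ⌊g⌋₊ + 1 := Nat.lt_floor_add_one g
  have e : ∀ k : ℕ, ((r * (g - k) + 1) * (r * (g - k) + 2) / 2
      + (s - 1) * (r * (g - k) * (r * (g - k) + 1) + 1 / 4) / 2)
      = s * r ^ 2 / 2 * (g - k) ^ 2 + (3 * r + (s - 1) * r) / 2 * (g - k)
        + (1 + (s - 1) / 8) := fun k => by ring
  simp only [e]
  rw [Finset.sum_add_distrib, Finset.sum_add_distrib, ← Finset.mul_sum, ← Finset.mul_sum,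
    aux_sum1, aux_sum2]
  simp only [Finset.sum_const, Finset.card_range, nsmul_eq_mul]
  push_cast
  generalize (⌊g⌋₊ : ℝ) = m at *
  have hp := aux_poly r g s hr hg hs
  have hf0 : 0 ≤ g - m := by linarith
  have hf1 : 0 ≤ 1 - (g - m) := by linarith
  have u2 : (m + 1) * g ^ 2 - g * (m * (m + 1)) + m * (m + 1) * (2 * m + 1) / 6
      ≤ g ^ 3 / 3 + g ^ 2 / 2 + g / 6 + 1 / 24 := by
    obtain ⟨f, rfl⟩ : ∃ f, g = m + f := ⟨g - m, by ring⟩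
    have hf0 : 0 ≤ f := by linarith
    have hf1 : 0 ≤ 1 - f := by linarith
    have : f * (1 - f) * (2 * f - 1) ≤ 1 / 4 := by
      nlinarith [mul_nonneg hf0 hf1, mul_nonneg (mul_nonneg hf0 hf1) hf1, sq_nonneg (f - 1 / 2)]
    nlinarith
  have u1 : (m + 1) * g - m * (m + 1) / 2 ≤ (g ^ 2 + g) / 2 + 1 / 8 := by
    nlinarith [sq_nonneg (g - m - 1 / 2)]
  have u0 : m + 1 ≤ g + 1 := by linarith
  rw [div_div, le_div_iff₀ (by positivity)]
  refine le_trans ?_ hp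
  have hs' : 0 ≤ s - 1 := by linarith
  have k2 := mul_le_mul_of_nonneg_left u2 (show 0 ≤ s * r ^ 2 / 2 by positivity)
  have k1 := mul_le_mul_of_nonneg_left u1 (show 0 ≤ (3 * r + (s - 1) * r) / 2 by positivity)
  have k0 := mul_le_mul_of_nonneg_right u0 (show 0 ≤ 1 + (s - 1) / 8 by positivity)
  have k := mul_le_mul_of_nonneg_right (add_le_add (add_le_add k2 k1) k0)
    (show 0 ≤ s * r * 6 by positivity)
  refine k.trans (le_of_eq ?_)
  ring

lemma aux_count (α β γ : ℝ) (hα : 0 < α) (hβ : 0 < β) (hγ : 0 < γ) :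
    ({t : ℤ × ℤ × ℤ | 0 < t.1 ∧ 0 < t.2.1 ∧ 0 < t.2.2 ∧
        ((t.1 : ℝ) - 1) / α + ((t.2.1 : ℝ) - 1) / β + ((t.2.2 : ℝ) - 1) / γ ≤ 1}.ncard : ℝ)
      ≤ ∑ k ∈ Finset.range (⌊γ⌋₊ + 1), ∑ j ∈ Finset.range (⌊β / γ * (γ - k)⌋₊ + 1),
          (α / β * (β / γ * (γ - k) - j) + 1) := by
  classical
  let F : Finset (ℤ × ℤ × ℤ) := (Finset.range (⌊γ⌋₊ + 1)).biUnion fun k =>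
    (Finset.range (⌊β / γ * (γ - k)⌋₊ + 1)).biUnion fun j =>
      (Finset.range (⌊α / β * (β / γ * (γ - k) - j)⌋₊ + 1)).image fun (i : ℕ) =>
        ((i : ℤ) + 1, (j : ℤ) + 1, (k : ℤ) + 1)
  have hsub : {t : ℤ × ℤ × ℤ | 0 < t.1 ∧ 0 < t.2.1 ∧ 0 < t.2.2 ∧
        ((t.1 : ℝ) - 1) / α + ((t.2.1 : ℝ) - 1) / β + ((t.2.2 : ℝ) - 1) / γ ≤ 1} ⊆ (F : Set _) := by
    rintro ⟨x, y, z⟩ ⟨hx, hy, hz, h⟩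
    simp only at hx hy hz h
    obtain ⟨i, rfl⟩ : ∃ i : ℕ, x = i + 1 := ⟨(x - 1).toNat, by omega⟩
    obtain ⟨j, rfl⟩ : ∃ i : ℕ, y = i + 1 := ⟨(y - 1).toNat, by omega⟩
    obtain ⟨k, rfl⟩ : ∃ i : ℕ, z = i + 1 := ⟨(z - 1).toNat, by omega⟩
    push_cast at h
    simp only [add_sub_cancel_right] at h
    have hi : (0:ℝ) ≤ i / α := by positivity
    have hj : (0:ℝ) ≤ j / β := by positivity
    have hk : (0:ℝ) ≤ k / γ := by positivity
    have h3 : (k : ℝ) ≤ γ := by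
      have : (k : ℝ) / γ ≤ 1 := by linarith
      rwa [div_le_one hγ] at this
    have h2 : (j : ℝ) ≤ β / γ * (γ - k) := by
      have : (j : ℝ) / β ≤ 1 - k / γ := by linarith
      rw [div_le_iff₀ hβ] at this
      refine this.trans (le_of_eq ?_)
      field_simp
    have h1 : (i : ℝ) ≤ α / β * (β / γ * (γ - k) - j) := by
      have : (i : ℝ) / α ≤ 1 - k / γ - j / β := by linarith
      rw [div_le_iff₀ hα] at this
      refine this.trans (le_of_eq ?_)
      field_simp
    simp only [F, Finset.coe_biUnion, Set.mem_iUnion, Finset.mem_coe, Finset.mem_image,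
      Finset.mem_range]
    exact ⟨k, Nat.lt_succ_of_le (Nat.le_floor h3), j, Nat.lt_succ_of_le (Nat.le_floor h2),
      i, Nat.lt_succ_of_le (Nat.le_floor h1), rfl⟩
  have hc := Set.ncard_le_ncard hsub F.finite_toSet
  rw [Set.ncard_coe_finset] at hc
  have hF : F.card ≤ ∑ k ∈ Finset.range (⌊γ⌋₊ + 1),
      ∑ j ∈ Finset.range (⌊β / γ * (γ - k)⌋₊ + 1), (⌊α / β * (β / γ * (γ - k) - j)⌋₊ + 1) := by
    refine Finset.card_biUnion_le.trans (Finset.sum_le_sum fun k _ => ?_)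
    refine Finset.card_biUnion_le.trans (Finset.sum_le_sum fun j _ => ?_)
    exact Finset.card_image_le.trans (by simp)
  have hcF : (_ : ℝ) ≤ _ := Nat.cast_le.2 (hc.trans hF)
  refine hcF.trans ?_
  push_cast
  refine Finset.sum_le_sum fun k hk => Finset.sum_le_sum fun j hj => ?_
  have hk' : (k : ℝ) ≤ γ :=
    (Nat.le_floor_iff hγ.le).1 (Nat.lt_succ_iff.1 (Finset.mem_range.1 hk))
  have hk0 : 0 ≤ γ - k := by linarith
  have hj' : (j : ℝ) ≤ β / γ * (γ - k) :=
    (Nat.le_floor_iff (by positivity)).1 (Nat.lt_succ_iff.1 (Finset.mem_range.1 hj))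
  have hj0 : 0 ≤ β / γ * (γ - k) - j := by linarith
  have := Nat.floor_le (show 0 ≤ α / β * (β / γ * (γ - k) - j) by positivity)
  linarith

theorem lattice_point_bound_strong
    (α β γ : ℝ) (hγ : 1 ≤ γ) (hβγ : γ ≤ β) (hαβ : β ≤ α) :
    let η := 1 / α + 1 / β + 1 / γ
    let A := α * (1 + η)
    let B := β * (1 + η)
    let C := γ * (1 + η)
    ({t : ℤ × ℤ × ℤ | 0 < t.1 ∧ 0 < t.2.1 ∧ 0 < t.2.2 ∧
        (t.1 : ℝ) / A + (t.2.1 : ℝ) / B + (t.2.2 : ℝ) / C ≤ 1}.ncard : ℝ)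
      ≤ (A - 1) * (B - 1) * (C - 1) / 6 := by
  intro η A B C
  have hγ0 : 0 < γ := by linarith
  have hβ0 : 0 < β := by linarith
  have hα0 : 0 < α := by linarith
  have hη : 0 < 1 + η := by positivity
  have hr : 1 ≤ β / γ := by rwa [one_le_div hγ0]
  have hs : 1 ≤ α / β := by rwa [one_le_div hβ0]
  have hset : {t : ℤ × ℤ × ℤ | 0 < t.1 ∧ 0 < t.2.1 ∧ 0 < t.2.2 ∧
        (t.1 : ℝ) / A + (t.2.1 : ℝ) / B + (t.2.2 : ℝ) / C ≤ 1} =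
      {t : ℤ × ℤ × ℤ | 0 < t.1 ∧ 0 < t.2.1 ∧ 0 < t.2.2 ∧
        ((t.1 : ℝ) - 1) / α + ((t.2.1 : ℝ) - 1) / β + ((t.2.2 : ℝ) - 1) / γ ≤ 1} := by
    ext t
    have e1 : (t.1 : ℝ) / A + (t.2.1 : ℝ) / B + (t.2.2 : ℝ) / C
        = ((t.1 : ℝ) / α + (t.2.1 : ℝ) / β + (t.2.2 : ℝ) / γ) / (1 + η) := by
      simp only [A, B, C, ← div_div, add_div]
    have e2 : ((t.1 : ℝ) - 1) / α + ((t.2.1 : ℝ) - 1) / β + ((t.2.2 : ℝ) - 1) / γ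
        = ((t.1 : ℝ) / α + (t.2.1 : ℝ) / β + (t.2.2 : ℝ) / γ) - η := by
      simp only [η]; ring
    simp only [Set.mem_ofPred_eq]
    rw [e1, e2, div_le_one hη, sub_le_iff_le_add]
  rw [hset]
  refine (aux_count α β γ hα0 hβ0 hγ0).trans ?_
  refine (Finset.sum_le_sum fun k hk => aux_inner _ _ ?_ hs).trans ?_
  · have hk' : (k : ℝ) ≤ γ :=
      (Nat.le_floor_iff hγ0.le).1 (Nat.lt_succ_iff.1 (Finset.mem_range.1 hk))
    have hk0 : 0 ≤ γ - k := by linarith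
    positivity
  refine (aux_outer (β / γ) γ (α / β) hr hγ hs).trans (le_of_eq ?_)
  simp only [A, B, C, η]
  field_simp
  ring
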